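/- Let T be a forest, let v be a stem of T that has a non-leaf neighbor, let R be the set of leaf neighbors of v, and let r = |R| ≥ 1. If r+1 is a triangular number, then χ_ISC(T) ≥ χ_ISC(T − R) + r + u_r. -/

import Mathlib

variable {V : Type} [Fintype V] [DecidableEq V]

/-- The `k`-th triangular number `t_k = C(k+1,2)`. -/
def tri (k : ℕ) : ℕ := (k + 1).choose 2

/-- A natural number is triangular if it equals `t_k` for some `k`. -/
def IsTriangular (m : ℕ) : Prop := ∃ k, m = tri k

/-- `uval r = max {k : t_k ≤ r}`. -/
def uval (r : ℕ) : ℕ := Nat.findGreatest (fun k => tri k ≤ r) r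

/-- The lists `L` admit a proper coloring of the subgraph of `G` induced by `S`,
with each vertex of `S` colored from its list. -/
def ColorableOn (G : SimpleGraph V) (S : Finset V) (L : V → Finset ℕ) : Prop :=
  ∃ φ : V → ℕ, (∀ v ∈ S, φ v ∈ L v) ∧ ∀ x ∈ S, ∀ y ∈ S, G.Adj x y → φ x ≠ φ y

/-- In the interactive sum choice game on the subgraph of `G` induced by `S`, starting
from lists `L`, Requester can force the game to end within `n` further rounds: either the
current lists already admit a proper coloring, or Requester can request a new color at
some vertex `v ∈ S` so that, whatever color `c ∉ L v` Supplier adds to `L v`, Requester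
can finish within `n - 1` further rounds. -/
def ReqWins (G : SimpleGraph V) (S : Finset V) : (V → Finset ℕ) → ℕ → Prop
  | L, 0 => ColorableOn G S L
  | L, n + 1 => ColorableOn G S L ∨
      ∃ v ∈ S, ∀ c ∉ L v, ReqWins G S (Function.update L v (insert c (L v))) n

/-- The interactive sum choice number of the subgraph of `G` induced by `S`:
the optimal number of rounds of the interactive sum choice game, namely the least `n`
such that Requester can force the game, started from empty lists, to end within `n`
rounds. -/
noncomputable def isc (G : SimpleGraph V) (S : Finset V) : ℕ :=
  sInf {n | ReqWins G S (fun _ => ∅) n}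

/-- A vertex is a leaf if it has exactly one neighbor. -/
def IsLeaf (G : SimpleGraph V) (v : V) : Prop := (G.neighborSet v).ncard = 1

/-- A stem in a forest: a vertex with at least one leaf neighbor and at most one
non-leaf neighbor. -/
def IsStem (G : SimpleGraph V) (v : V) : Prop :=
  (∃ w, G.Adj v w ∧ IsLeaf G w) ∧ {w | G.Adj v w ∧ ¬ IsLeaf G w}.ncard ≤ 1

set_option linter.unusedSectionVars false

lemma ColorableOn.reqWins {G : SimpleGraph V} {S : Finset V} {L : V → Finset ℕ}
    (h : ColorableOn G S L) (n : ℕ) : ReqWins G S L n := by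
  cases n with
  | zero => exact h
  | succ n => exact Or.inl h

lemma ReqWins.mono {G : SimpleGraph V} {S : Finset V} {L : V → Finset ℕ} {a b : ℕ}
    (h : ReqWins G S L a) (hab : a ≤ b) : ReqWins G S L b := by
  induction b generalizing a L with
  | zero => rwa [Nat.le_zero.mp hab] at h
  | succ b ih =>
    cases a with
    | zero => exact Or.inl h
    | succ a =>
      rcases h with h | ⟨x, hx, h⟩
      · exact Or.inl h
      · exact Or.inr ⟨x, hx, fun c hc => ih (h c hc) (by omega)⟩

lemma colorableOn_of_card_le (G : SimpleGraph V) (S : Finset V) (L : V → Finset ℕ)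
    (h : ∀ x, Fintype.card V ≤ (L x).card) : ColorableOn G S L := by
  obtain ⟨φ, hinj, hφ⟩ := (Finset.all_card_le_biUnion_card_iff_exists_injective L).mp (by
    intro s
    rcases s.eq_empty_or_nonempty with rfl | ⟨x, hx⟩
    · simp
    · exact (Finset.card_le_univ s).trans
        ((h x).trans (Finset.card_le_card (Finset.subset_biUnion_of_mem L hx))))
  exact ⟨φ, fun x _ => hφ x, fun x _ y _ hxy he => hxy.ne (hinj he)⟩

/-- Requester can always force the game to end by making all lists large. -/
lemma reqWins_univ_of_sum_le (G : SimpleGraph V) (n : ℕ) (L : V → Finset ℕ)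
    (h : ∑ x, (Fintype.card V - (L x).card) ≤ n) : ReqWins G Finset.univ L n := by
  induction n generalizing L with
  | zero =>
    refine colorableOn_of_card_le G _ L fun x => ?_
    have := (Finset.sum_eq_zero_iff.mp (Nat.le_zero.mp h)) x (Finset.mem_univ x)
    omega
  | succ n ih =>
    by_cases hL : ∀ x, Fintype.card V ≤ (L x).card
    · exact (colorableOn_of_card_le G _ L hL).reqWins _
    · push Not at hL
      obtain ⟨x, hx⟩ := hL
      refine Or.inr ⟨x, Finset.mem_univ x, fun c hc => ih _ ?_⟩
      have hlt : ∑ y, (Fintype.card V - (Function.update L x (insert c (L x)) y).card)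
          < ∑ y, (Fintype.card V - (L y).card) := by
        refine Finset.sum_lt_sum (fun y _ => ?_) ⟨x, Finset.mem_univ x, ?_⟩
        · by_cases hy : y = x
          · subst hy
            simp only [Function.update_self, Finset.card_insert_of_notMem hc]
            omega
          · simp [Function.update_of_ne hy]
        · simp only [Function.update_self, Finset.card_insert_of_notMem hc]
          omega
      omega

lemma reqWins_isc_univ (G : SimpleGraph V) :
    ReqWins G Finset.univ (fun _ => ∅) (isc G Finset.univ) :=
  Nat.sInf_mem (s := {n | ReqWins G Finset.univ (fun _ => ∅) n})
    ⟨_, reqWins_univ_of_sum_le G _ _ le_rfl⟩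

lemma tri_succ (k : ℕ) : tri (k + 1) = tri k + (k + 1) := by
  rw [tri, tri, Nat.choose_succ_succ (k + 1) 1, Nat.choose_one_right, add_comm]

lemma tri_mono : Monotone tri :=
  monotone_nat_of_le_succ fun k => by rw [tri_succ]; omega

lemma uval_lt {r k : ℕ} (h : r < tri k) : uval r < k := by
  have hspec : tri (uval r) ≤ r :=
    Nat.findGreatest_spec (P := fun k => tri k ≤ r) (Nat.zero_le r) (by simp [tri])
  by_contra! hk
  have := tri_mono hk
  omega

/-- A set of at least `t_k - 1` elements can be partitioned so that class `s` has at least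
`s` elements whenever `2 ≤ s ≤ k`. -/
lemma exists_classes {α : Type*} [DecidableEq α] (k : ℕ) (R : Finset α)
    (hR : tri k ≤ R.card + 1) :
    ∃ g : α → ℕ, ∀ s, 2 ≤ s → s ≤ k → s ≤ {x ∈ R | g x = s}.card := by
  induction k generalizing R with
  | zero => exact ⟨fun _ => 0, fun s h₁ h₂ => by omega⟩
  | succ k ih =>
    rcases Nat.eq_zero_or_pos k with rfl | hk
    · exact ⟨fun _ => 0, fun s h₁ h₂ => by omega⟩
    have h1 : 1 ≤ tri k := tri_mono hk
    rw [tri_succ] at hR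
    obtain ⟨A, hAR, hA⟩ := Finset.exists_subset_card_eq (show k + 1 ≤ R.card by omega)
    obtain ⟨g, hg⟩ := ih (R \ A) (by rw [Finset.card_sdiff_of_subset hAR]; omega)
    refine ⟨fun x => if x ∈ A then k + 1 else g x, fun s h₁ h₂ => ?_⟩
    rcases h₂.eq_or_lt with rfl | h₂
    · refine hA.symm.le.trans (Finset.card_le_card fun x hx => ?_)
      simp [hx, hAR hx]
    · refine (hg s h₁ (by omega)).trans (Finset.card_le_card fun x hx => ?_)
      simp only [Finset.mem_filter, Finset.mem_sdiff] at hx ⊢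
      exact ⟨hx.1.1, by rw [if_neg hx.1.2]; exact hx.2⟩

/-- The lists `L` of a game on the whole graph simulate the lists `L'` of a game on the graph
with `R` removed: colors are shifted by `k + 1`, the vertex `v` receives the `m` largest of the
colors `2, …, k` before any color coming from `L'`, and the first color received by `x ∈ R`
is `g x`. -/
structure Simulates (v : V) (R : Finset V) (k : ℕ) (g : V → ℕ) (m : ℕ)
    (L L' : V → Finset ℕ) : Prop where
  lt : m < k
  eq_of_nonempty : (L' v).Nonempty → m + 1 = k
  other : ∀ x ∉ R, x ≠ v → L x = (L' x).image (· + (k + 1))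
  center : L v = Finset.Ioc (k - m) k ∪ (L' v).image (· + (k + 1))
  first : ∀ x ∈ R, (L x).Nonempty → g x ∈ L x

lemma Simulates.mem_iff {v : V} {R : Finset V} {k m : ℕ} {g : V → ℕ} {L L' : V → Finset ℕ}
    (h : Simulates v R k g m L L') {x : V} (hx : x ∉ R) (c : ℕ) :
    c + (k + 1) ∈ L x ↔ c ∈ L' x := by
  by_cases hxv : x = v
  · subst hxv
    rw [h.center]
    simp
    omega
  · rw [h.other x hx hxv]
    simp

lemma Simulates.update_first {v : V} {R : Finset V} {k m : ℕ} {g : V → ℕ}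
    {L L' : V → Finset ℕ} (h : Simulates v R k g m L L') (hvR : v ∉ R) {x : V} (hx : x ∈ R)
    {c : ℕ} (hc : L x = ∅ → c = g x) :
    Simulates v R k g m (Function.update L x (insert c (L x))) L' where
  lt := h.lt
  eq_of_nonempty := h.eq_of_nonempty
  other y hy hyv := by
    rw [Function.update_of_ne (by rintro rfl; exact hy hx), h.other y hy hyv]
  center := by
    rw [Function.update_of_ne (by rintro rfl; exact hvR hx), h.center]
  first y hy hne := by
    by_cases hyx : y = x
    · subst hyx
      rw [Function.update_self]
      rcases (L y).eq_empty_or_nonempty with he | hne'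
      · simp [hc he]
      · exact Finset.mem_insert_of_mem (h.first y hy hne')
    · rw [Function.update_of_ne hyx] at hne ⊢
      exact h.first y hy hne

lemma Simulates.update_center {v : V} {R : Finset V} {k m : ℕ} {g : V → ℕ}
    {L L' : V → Finset ℕ} (h : Simulates v R k g m L L') (hvR : v ∉ R) (hm : m + 1 < k) :
    Simulates v R k g (m + 1) (Function.update L v (insert (k - m) (L v))) L' where
  lt := hm
  eq_of_nonempty hne := by
    have := h.eq_of_nonempty hne
    omega
  other y hy hyv := by
    rw [Function.update_of_ne hyv, h.other y hy hyv]
  center := by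
    have he : insert (k - m) (Finset.Ioc (k - m) k) = Finset.Ioc (k - (m + 1)) k := by
      ext a
      simp only [Finset.mem_insert, Finset.mem_Ioc]
      omega
    rw [Function.update_self, h.center, ← Finset.insert_union, he]
  first y hy hne := by
    have hyv : y ≠ v := by rintro rfl; exact hvR hy
    rw [Function.update_of_ne hyv] at hne ⊢
    exact h.first y hy hne

lemma Simulates.update_both {v : V} {R : Finset V} {k m : ℕ} {g : V → ℕ}
    {L L' : V → Finset ℕ} (h : Simulates v R k g m L L') {x : V} (hx : x ∉ R)
    (hm : x = v → m + 1 = k) (c : ℕ) :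
    Simulates v R k g m (Function.update L x (insert (c + (k + 1)) (L x)))
      (Function.update L' x (insert c (L' x))) where
  lt := h.lt
  eq_of_nonempty hne := by
    by_cases hxv : x = v
    · exact hm hxv
    · rw [Function.update_of_ne (Ne.symm hxv)] at hne
      exact h.eq_of_nonempty hne
  other y hy hyv := by
    by_cases hyx : y = x
    · subst hyx
      rw [Function.update_self, Function.update_self, h.other y hy hyv, Finset.image_insert]
    · rw [Function.update_of_ne hyx, Function.update_of_ne hyx, h.other y hy hyv]
  center := by
    by_cases hxv : x = v
    · subst hxv
      rw [Function.update_self, Function.update_self, h.center, Finset.image_insert,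
        Finset.union_insert]
    · rw [Function.update_of_ne (Ne.symm hxv), Function.update_of_ne (Ne.symm hxv), h.center]
  first y hy hne := by
    have hyx : y ≠ x := by rintro rfl; exact hx hy
    rw [Function.update_of_ne hyx] at hne ⊢
    exact h.first y hy hne

lemma sum_card_update {R : Finset V} {x : V} (hx : x ∈ R) {L : V → Finset ℕ} {c : ℕ}
    (hc : c ∉ L x) :
    ∑ y ∈ R, (Function.update L x (insert c (L x)) y).card = ∑ y ∈ R, (L y).card + 1 := by
  rw [← Finset.add_sum_erase _ _ hx, ← Finset.add_sum_erase R (fun y => (L y).card) hx,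
    Function.update_self, Finset.card_insert_of_notMem hc,
    Finset.sum_congr rfl fun y hy => by rw [Function.update_of_ne (Finset.ne_of_mem_erase hy)]]
  omega

lemma sum_card_update_of_notMem {R : Finset V} {x : V} (hx : x ∉ R) (L : V → Finset ℕ)
    (s : Finset ℕ) :
    ∑ y ∈ R, (Function.update L x s y).card = ∑ y ∈ R, (L y).card :=
  Finset.sum_congr rfl fun y hy => by
    rw [Function.update_of_ne (by rintro rfl; exact hx hy)]

/-- If everything but `v` can be colored and `v` has at most one neighbor in `S`, then two
requests at `v` suffice. -/
lemma reqWins_two {G : SimpleGraph V} {S : Finset V} {v : V} (hv : v ∈ S)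
    (huniq : ∀ x ∈ S, ∀ y ∈ S, G.Adj v x → G.Adj v y → x = y) {L : V → Finset ℕ}
    (h : ColorableOn G (S.erase v) L) : ReqWins G S L 2 := by
  obtain ⟨φ, hφ, hproper⟩ := h
  refine Or.inr ⟨v, hv, fun a ha => Or.inr ⟨v, hv, fun b hb => ?_⟩⟩
  simp only [Function.update_self, Function.update_idem] at hb ⊢
  obtain ⟨c, hc, hcw⟩ : ∃ c ∈ insert b (insert a (L v)),
      ∀ w ∈ S, G.Adj v w → φ w ≠ c := by
    by_cases hw : ∃ w ∈ S, G.Adj v w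
    · obtain ⟨w, hwS, hvw⟩ := hw
      have hab : b ≠ a := by rintro rfl; simp at hb
      by_cases hwa : φ w = a
      · refine ⟨b, by simp, fun y hy hvy => ?_⟩
        rw [huniq y hy w hwS hvy hvw, hwa]
        exact hab.symm
      · refine ⟨a, by simp, fun y hy hvy => ?_⟩
        rwa [huniq y hy w hwS hvy hvw]
    · exact ⟨a, by simp, fun w hwS hvw => (hw ⟨w, hwS, hvw⟩).elim⟩
  refine ⟨Function.update φ v c, fun x hx => ?_, fun x hx y hy hxy => ?_⟩
  · by_cases hxv : x = v
    · subst hxv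
      simpa using hc
    · simpa [Function.update_of_ne hxv] using hφ x (Finset.mem_erase.mpr ⟨hxv, hx⟩)
  · by_cases hxv : x = v
    · subst hxv
      rw [Function.update_self, Function.update_of_ne hxy.ne']
      exact (hcw y hy hxy).symm
    · by_cases hyv : y = v
      · subst hyv
        rw [Function.update_self, Function.update_of_ne hxv]
        exact hcw x hx hxy.symm
      · rw [Function.update_of_ne hxv, Function.update_of_ne hyv]
        exact hproper x (Finset.mem_erase.mpr ⟨hxv, hx⟩) y (Finset.mem_erase.mpr ⟨hyv, hy⟩) hxy

/-- A proper coloring of the simulating lists restricts to a proper coloring of the simulated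
lists wherever it only uses shifted colors. -/
lemma Simulates.colorableOn {G : SimpleGraph V} {v : V} {R : Finset V} {k m : ℕ} {g : V → ℕ}
    {L L' : V → Finset ℕ} (h : Simulates v R k g m L L') {S : Finset V} {φ : V → ℕ}
    (hS : ∀ x ∈ S, x ∉ R) (hφ : ∀ x, φ x ∈ L x) (hproper : ∀ x y, G.Adj x y → φ x ≠ φ y)
    (hshift : ∀ x ∈ S, k + 1 ≤ φ x) : ColorableOn G S L' := by
  refine ⟨fun x => φ x - (k + 1), fun x hx => ?_, fun x hx y hy hxy => ?_⟩
  · rw [← h.mem_iff (hS x hx), Nat.sub_add_cancel (hshift x hx)]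
    exact hφ x
  · have := hproper x y hxy
    have := hshift x hx
    have := hshift y hy
    dsimp only
    omega

lemma Simulates.reqWins_of_colorableOn {G : SimpleGraph V} {v : V} {R : Finset V} {k m : ℕ}
    {g : V → ℕ} {L L' : V → Finset ℕ} (h : Simulates v R k g m L L') (hvR : v ∉ R)
    (hadj : ∀ x ∈ R, G.Adj v x)
    (huniq : ∀ x ∈ Finset.univ \ R, ∀ y ∈ Finset.univ \ R, G.Adj v x → G.Adj v y → x = y)
    (hg : ∀ s, 2 ≤ s → s ≤ k → s ≤ {x ∈ R | g x = s}.card)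
    (hcol : ColorableOn G Finset.univ L) (n : ℕ) :
    ∃ n', n + ∑ x ∈ R, (L x).card + m = n' + R.card + (k - 1) ∧
      ReqWins G (Finset.univ \ R) L' n' := by
  obtain ⟨φ, hφ, hproper⟩ := hcol
  replace hφ : ∀ x, φ x ∈ L x := fun x => hφ x (Finset.mem_univ x)
  replace hproper : ∀ x y, G.Adj x y → φ x ≠ φ y :=
    fun x y => hproper x (Finset.mem_univ x) y (Finset.mem_univ y)
  have hlt := h.lt
  have hother : ∀ x ∉ R, x ≠ v → k + 1 ≤ φ x := by
    intro x hx hxv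
    have := hφ x
    rw [h.other x hx hxv, Finset.mem_image] at this
    obtain ⟨c, -, hc⟩ := this
    omega
  have hsum : ∑ x ∈ R, (1 + if g x = φ v then 1 else 0) ≤ ∑ x ∈ R, (L x).card := by
    refine Finset.sum_le_sum fun x hx => ?_
    have hne : (L x).Nonempty := ⟨_, hφ x⟩
    split_ifs with hgx
    · exact Finset.one_lt_card.mpr
        ⟨φ x, hφ x, g x, h.first x hx hne, fun he => hproper v x (hadj x hx) (by omega)⟩
    · exact hne.card_pos
  rw [Finset.sum_add_distrib, ← Finset.card_filter, Finset.sum_const, smul_eq_mul,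
    mul_one] at hsum
  have hv := hφ v
  rw [h.center, Finset.mem_union, Finset.mem_Ioc, Finset.mem_image] at hv
  rcases hv with hv | ⟨c, hcL, hc⟩
  · have := hg (φ v) (by omega) hv.2
    refine ⟨n + ∑ x ∈ R, (L x).card + m - R.card - (k - 1), by omega, ?_⟩
    refine (reqWins_two (by simpa using hvR) huniq ?_).mono (by omega)
    refine h.colorableOn (fun x hx => ?_) hφ hproper fun x hx => ?_
    · simp only [Finset.mem_erase, Finset.mem_sdiff] at hx
      exact hx.2.2
    · simp only [Finset.mem_erase, Finset.mem_sdiff] at hx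
      exact hother x hx.2.2 hx.1
  · have := h.eq_of_nonempty ⟨c, hcL⟩
    refine ⟨n + ∑ x ∈ R, (L x).card + m - R.card - (k - 1), by omega, ?_⟩
    refine (h.colorableOn (fun x hx => (Finset.mem_sdiff.mp hx).2) hφ hproper
      fun x hx => ?_).reqWins _
    by_cases hxv : x = v
    · subst hxv
      omega
    · exact hother x (Finset.mem_sdiff.mp hx).2 hxv

lemma Simulates.reqWins {G : SimpleGraph V} {v : V} {R : Finset V} {k : ℕ} {g : V → ℕ}
    (hvR : v ∉ R) (hadj : ∀ x ∈ R, G.Adj v x)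
    (huniq : ∀ x ∈ Finset.univ \ R, ∀ y ∈ Finset.univ \ R, G.Adj v x → G.Adj v y → x = y)
    (hg : ∀ s, 2 ≤ s → s ≤ k → s ≤ {x ∈ R | g x = s}.card) {n m : ℕ} {L L' : V → Finset ℕ}
    (h : Simulates v R k g m L L') (hwin : ReqWins G Finset.univ L n) :
    ∃ n', n + ∑ x ∈ R, (L x).card + m = n' + R.card + (k - 1) ∧
      ReqWins G (Finset.univ \ R) L' n' := by
  induction n generalizing m L L' with
  | zero => exact h.reqWins_of_colorableOn hvR hadj huniq hg hwin 0
  | succ n ih =>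
    rcases hwin with hcol | ⟨x, -, hwin⟩
    · exact h.reqWins_of_colorableOn hvR hadj huniq hg hcol (n + 1)
    by_cases hxR : x ∈ R
    · obtain ⟨c, hcL, hc⟩ : ∃ c ∉ L x, L x = ∅ → c = g x := by
        rcases (L x).eq_empty_or_nonempty with he | hne
        · exact ⟨g x, by simp [he], fun _ => rfl⟩
        · obtain ⟨c, hc⟩ := Infinite.exists_notMem_finset (L x)
          exact ⟨c, hc, fun he => (hne.ne_empty he).elim⟩
      obtain ⟨n', hn', hw⟩ := ih (h.update_first hvR hxR hc) (hwin c hcL)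
      rw [sum_card_update hxR hcL] at hn'
      exact ⟨n', by omega, hw⟩
    by_cases hxm : x = v ∧ m + 1 < k
    · obtain ⟨rfl, hm⟩ := hxm
      have hc : k - m ∉ L x := by
        rw [h.center]
        simp
        omega
      obtain ⟨n', hn', hw⟩ := ih (h.update_center hvR hm) (hwin _ hc)
      rw [sum_card_update_of_notMem hxR] at hn'
      exact ⟨n', by omega, hw⟩
    have hlt := h.lt
    have hstep : ∀ c ∉ L' x, ∃ n', n + ∑ x ∈ R, (L x).card + m = n' + R.card + (k - 1) ∧
        ReqWins G (Finset.univ \ R) (Function.update L' x (insert c (L' x))) n' := by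
      intro c hc
      have := ih (h.update_both hxR (fun hxv => by have := not_and.mp hxm hxv; omega) c)
        (hwin _ (mt (h.mem_iff hxR c).mp hc))
      rwa [sum_card_update_of_notMem hxR] at this
    obtain ⟨c₀, hc₀⟩ := Infinite.exists_notMem_finset (L' x)
    obtain ⟨n', hn', -⟩ := hstep c₀ hc₀
    refine ⟨n' + 1, by omega, Or.inr ⟨x, by simpa using hxR, fun c hc => ?_⟩⟩
    obtain ⟨p, hp, hw⟩ := hstep c hc
    rwa [show n' = p by omega]

/-- If `v` is a stem with a non-leaf neighbor in a forest `T`, with `r ≥ 1` leaf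
neighbors (forming the set `R`), and `r + 1` is triangular, then
`χ_ISC(T) ≥ χ_ISC(T - R) + r + u_r`. -/
theorem stmt18 (G : SimpleGraph V) (hG : G.IsAcyclic) (v : V) (R : Finset V)
    (hv : IsStem G v) (hw : ∃ w, G.Adj v w ∧ ¬ IsLeaf G w)
    (hR : ∀ w, w ∈ R ↔ (G.Adj v w ∧ IsLeaf G w)) (hr : 1 ≤ R.card)
    (htri : IsTriangular (R.card + 1)) :
    isc G (Finset.univ \ R) + R.card + uval R.card ≤ isc G Finset.univ := by
  obtain ⟨k, hk⟩ := htri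
  have hu : uval R.card < k := uval_lt (by omega)
  have hvR : v ∉ R := fun h => G.loopless.irrefl v ((hR v).mp h).1
  obtain ⟨g, hg⟩ := exists_classes k R hk.ge
  have huniq : ∀ x ∈ Finset.univ \ R, ∀ y ∈ Finset.univ \ R,
      G.Adj v x → G.Adj v y → x = y := by
    intro x hx y hy hvx hvy
    have hmem : ∀ z ∈ Finset.univ \ R, G.Adj v z → z ∈ {w | G.Adj v w ∧ ¬ IsLeaf G w} :=
      fun z hz hvz => ⟨hvz, fun hl => (Finset.mem_sdiff.mp hz).2 ((hR z).mpr ⟨hvz, hl⟩)⟩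
    exact (Set.ncard_le_one (Set.toFinite _)).mp hv.2 x (hmem x hx hvx) y (hmem y hy hvy)
  have hsim : Simulates v R k g 0 (fun _ => ∅) (fun _ => ∅) :=
    ⟨by omega, by simp, by simp, by simp, by simp⟩
  obtain ⟨n, hn, hwin⟩ := hsim.reqWins hvR (fun x hx => ((hR x).mp hx).1) huniq hg
    (reqWins_isc_univ G)
  have hle : isc G (Finset.univ \ R) ≤ n := Nat.sInf_le hwin
  simp only [Finset.card_empty, Finset.sum_const_zero] at hn
  omega
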